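/- For every compact Hausdorff space X, the set I_ω(X) of all finite-support idempotent probability measures is dense in I(X) with respect to the topology of pointwise convergence: for every idempotent probability measure μ on X, every finite list φ_1, …, φ_n ∈ C(X,ℝ) and every ε > 0, there exists a finite-support idempotent probability measure ν with |μ(φ_i) − ν(φ_i)| < ε for i = 1, …, n. -/

import Mathlib

/-- An idempotent probability measure on a topological space `X`. -/
def IsIdempotentProbMeasure {X : Type*} [TopologicalSpace X] (μ : C(X, ℝ) → ℝ) : Prop :=
  (∀ c : ℝ, μ (ContinuousMap.const X c) = c) ∧
  (∀ (φ : C(X, ℝ)) (c : ℝ), μ (φ + ContinuousMap.const X c) = μ φ + c) ∧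
  (∀ φ ψ : C(X, ℝ), μ (φ ⊔ ψ) = max (μ φ) (μ ψ))

namespace IsIdempotentProbMeasure

variable {X : Type*} [TopologicalSpace X] {μ : C(X, ℝ) → ℝ}

theorem mono (hμ : IsIdempotentProbMeasure μ) : Monotone μ := fun φ ψ h => by
  have := hμ.2.2 φ ψ
  rw [sup_eq_right.2 h] at this
  exact this ▸ le_max_left _ _

theorem map_zero (hμ : IsIdempotentProbMeasure μ) : μ 0 = 0 := hμ.1 0

theorem map_sub_const_self (hμ : IsIdempotentProbMeasure μ) (φ : C(X, ℝ)) :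
    μ (φ - ContinuousMap.const X (μ φ)) = 0 := by
  have h : φ - ContinuousMap.const X (μ φ) = φ + ContinuousMap.const X (-μ φ) := by
    ext x
    simp [sub_eq_add_neg]
  rw [h, hμ.2.1, add_neg_cancel]

/-- Among finitely many functions of measure zero, each is, at some point, within `δ` of
dominating all the others. -/
theorem exists_forall_le_add (hμ : IsIdempotentProbMeasure μ) {ι : Type*} [Fintype ι]
    (g : ι → C(X, ℝ)) (hg : ∀ i, μ (g i) = 0) {δ : ℝ} (hδ : 0 < δ) (j : ι) :
    ∃ x, ∀ i, g i x ≤ g j x + δ := by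
  by_contra! h
  have hne : (Finset.univ : Finset ι).Nonempty := ⟨j, Finset.mem_univ j⟩
  have hsup : μ (Finset.univ.sup' hne g) = 0 := by
    rw [Finset.apply_sup'_eq_sup'_comp hne μ hμ.2.2]
    simp [hg]
  have hle : g j + ContinuousMap.const X δ ≤ Finset.univ.sup' hne g := fun x => by
    obtain ⟨i, hi⟩ := h x
    exact hi.le.trans (Finset.le_sup' g (Finset.mem_univ i) x)
  have := hμ.mono hle
  rw [hμ.2.1, hg, hsup] at this
  linarith

end IsIdempotentProbMeasure

/-- Density of finite-support idempotent probability measures `I_ω(X)` in `I(X)` with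
respect to pointwise convergence: for every idempotent probability measure `μ`, finitely
many test functions `φ_1, …, φ_n` and every `ε > 0`, there is a finite-support idempotent
probability measure `ν = ⊕_i λ_i ⊙ δ_{x_i}` with `|μ(φ_j) − ν(φ_j)| < ε` for all `j`. -/
theorem finSupport_dense {X : Type*} [TopologicalSpace X] [CompactSpace X] [T2Space X]
    (μ : C(X, ℝ) → ℝ) (hμ : IsIdempotentProbMeasure μ)
    {n : ℕ} (φ : Fin n → C(X, ℝ)) (ε : ℝ) (hε : 0 < ε) :
    ∃ (k : ℕ) (_ : 0 < k) (x : Fin k → X) (lam : Fin k → ℝ),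
      (⨆ i, lam i) = 0 ∧
      ∀ j : Fin n, |μ (φ j) - ⨆ i, (lam i + (φ j) (x i))| < ε := by
  let g : Fin (n + 1) → C(X, ℝ) :=
    Fin.cons 0 fun j => φ j - ContinuousMap.const X (μ (φ j))
  have hg : ∀ i, μ (g i) = 0 :=
    Fin.cases hμ.map_zero fun j => hμ.map_sub_const_self (φ j)
  have hgs : ∀ (j : Fin n) (y : X), g j.succ y = φ j y - μ (φ j) := fun _ _ => rfl
  choose x hx using hμ.exists_forall_le_add g hg (half_pos hε)
  let lam : Fin (n + 1) → ℝ := Fin.cons 0 fun j => -g j.succ (x j.succ) - ε / 2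
  have hlam : ∀ j : Fin n, lam j.succ = -g j.succ (x j.succ) - ε / 2 := fun _ => rfl
  refine ⟨n + 1, n.succ_pos, x, lam, le_antisymm (ciSup_le ?_) ?_, fun j => ?_⟩
  · refine Fin.cases le_rfl fun j => ?_
    have h : (0 : ℝ) ≤ g j.succ (x j.succ) + ε / 2 := hx j.succ 0
    rw [hlam]
    linarith
  · exact le_ciSup (f := lam) (Set.finite_range _).bddAbove 0
  · have hupper : ⨆ i, (lam i + φ j (x i)) ≤ μ (φ j) + ε / 2 := by
      refine ciSup_le (Fin.cases ?_ fun i => ?_)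
      · have h : g j.succ (x 0) ≤ 0 + ε / 2 := hx 0 j.succ
        have h0 : lam 0 = 0 := rfl
        rw [hgs] at h
        linarith
      · have h := hx i.succ j.succ
        rw [hgs j] at h
        rw [hlam]
        linarith
    have hlower : lam j.succ + φ j (x j.succ) ≤ ⨆ i, (lam i + φ j (x i)) :=
      le_ciSup (f := fun i => lam i + φ j (x i)) (Set.finite_range _).bddAbove j.succ
    rw [hlam, hgs] at hlower
    rw [abs_lt]
    constructor <;> linarith
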